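/- arXiv:2310.16404 — 4 statements merged into one kernel-verified Lean document; each statement's English description precedes it below -/
import Mathlib

section
/- Let a > 0, t_1 > 0, and let {t_k}_{k≥1} be the sequence defined by t_{k+1} = √(t_k² + a·t_k). Then, with b = 2·a·t_1/(a + 4·t_1) (which satisfies b < a/2), one has t_k ≥ t_1 + b·(k − 1) for all k ≥ 1. -/
set_option autoImplicit false

/-- One step of `x ↦ √(x² + a·x)` increases `x ≥ s` by at least `b = 2·a·s/(a + 4·s)`. -/
theorem add_le_sqrt_sq_add_mul {a b s x : ℝ} (hb : 0 ≤ b) (hba : b < a / 2)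
    (hbs : b * (a + 4 * s) = 2 * a * s) (hx : s ≤ x) : x + b ≤ √(x ^ 2 + a * x) := by
  apply Real.le_sqrt_of_sq_le
  have hmono : s * (a - 2 * b) ≤ x * (a - 2 * b) :=
    mul_le_mul_of_nonneg_right hx (by linarith)
  have hsq : b * b ≤ b * (a / 2) := mul_le_mul_of_nonneg_left hba.le hb
  linarith

/-- If `a > 0`, `t 1 > 0` and `t (k+1) = √(t k ² + a · t k)` for all `k ≥ 1`, then with
`b = 2·a·t 1/(a + 4·t 1)` one has `t k ≥ t 1 + b·(k − 1)` for all `k ≥ 1`. -/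
theorem stmt2 (a : ℝ) (ha : 0 < a) (t : ℕ → ℝ) (ht1 : 0 < t 1)
    (hrec : ∀ k ≥ 1, t (k + 1) = Real.sqrt (t k ^ 2 + a * t k)) :
    2 * a * t 1 / (a + 4 * t 1) < a / 2 ∧
      ∀ k ≥ 1, t k ≥ t 1 + 2 * a * t 1 / (a + 4 * t 1) * ((k : ℝ) - 1) := by
  have hpos : 0 < a + 4 * t 1 := by positivity
  have hb : 0 ≤ 2 * a * t 1 / (a + 4 * t 1) := by positivity
  have hbs : 2 * a * t 1 / (a + 4 * t 1) * (a + 4 * t 1) = 2 * a * t 1 :=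
    div_mul_cancel₀ _ hpos.ne'
  have hba : 2 * a * t 1 / (a + 4 * t 1) < a / 2 := by
    rw [div_lt_iff₀ hpos]
    nlinarith [mul_pos ha ha]
  refine ⟨hba, fun k hk => ?_⟩
  induction k, hk using Nat.le_induction with
  | base => simp
  | succ k hk ih =>
    have hk' : (0 : ℝ) ≤ (k : ℝ) - 1 := sub_nonneg.mpr (by exact_mod_cast hk)
    have hstep := add_le_sqrt_sq_add_mul hb hba hbs (x := t k)
      (by linarith [mul_nonneg hb hk'])
    rw [hrec k hk]
    push_cast
    linarith
end

section
/- Let {h_k}_{k≥1} be a sequence of vectors in ℝ^n and {a_k}_{k≥1} a sequence in [0,1). If there is C ≥ 0 such that ‖h_{k+1} + Σ_{i=1}^{k} a_i·h_i‖ ≤ C for all k ≥ 1, then sup_{k≥1} ‖h_k‖ ≤ ‖h_1‖ + 2C. -/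
set_option autoImplicit false

/-- If `h (k + 1) + ∑_{i=1}^{k} a i • h i` is bounded by `C` for all `k ≥ 1`, then each partial sum
is a convex combination of the previous one and a vector of norm at most `C`, so the partial sums
are bounded by `‖h 1‖ + C`. -/
lemma norm_sum_smul_le_of_norm_add_sum_le {E : Type*} [SeminormedAddCommGroup E] [NormedSpace ℝ E]
    (h : ℕ → E) (a : ℕ → ℝ) (ha : ∀ k ≥ 1, 0 ≤ a k ∧ a k ≤ 1) (C : ℝ) (hC : 0 ≤ C)
    (hbound : ∀ k ≥ 1, ‖h (k + 1) + ∑ i ∈ Finset.Icc 1 k, a i • h i‖ ≤ C) :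
    ∀ k ≥ 1, ‖∑ i ∈ Finset.Icc 1 k, a i • h i‖ ≤ ‖h 1‖ + C := by
  intro k hk
  induction k, hk using Nat.le_induction with
  | base =>
    obtain ⟨h0, h1⟩ := ha 1 le_rfl
    rw [Finset.Icc_self, Finset.sum_singleton, norm_smul, Real.norm_of_nonneg h0]
    nlinarith [norm_nonneg (h 1)]
  | succ k hk ih =>
    obtain ⟨h0, h1⟩ := ha (k + 1) (by omega)
    have hb := hbound k hk
    rw [Finset.sum_Icc_succ_top (by omega)]
    set S := ∑ i ∈ Finset.Icc 1 k, a i • h i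
    have hS : S + a (k + 1) • h (k + 1)
        = (1 - a (k + 1)) • S + a (k + 1) • (h (k + 1) + S) := by
      module
    calc ‖S + a (k + 1) • h (k + 1)‖
        ≤ (1 - a (k + 1)) * ‖S‖ + a (k + 1) * ‖h (k + 1) + S‖ := by
          rw [hS]
          refine (norm_add_le _ _).trans_eq ?_
          rw [norm_smul, norm_smul, Real.norm_of_nonneg h0, Real.norm_of_nonneg (by linarith)]
      _ ≤ (1 - a (k + 1)) * (‖h 1‖ + C) + a (k + 1) * (‖h 1‖ + C) := by
          have := norm_nonneg (h 1)
          gcongr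
          linarith
      _ = ‖h 1‖ + C := by ring

/-- If `{h k}` are vectors in `ℝ^n`, `{a k} ⊆ [0,1)`, and
`‖h (k+1) + ∑_{i=1}^{k} a i • h i‖ ≤ C` for all `k ≥ 1`, then
`‖h k‖ ≤ ‖h 1‖ + 2 C` for all `k ≥ 1`. -/
theorem stmt5 {n : ℕ} (h : ℕ → EuclideanSpace ℝ (Fin n)) (a : ℕ → ℝ)
    (ha : ∀ k ≥ 1, 0 ≤ a k ∧ a k < 1) (C : ℝ) (hC : 0 ≤ C)
    (hbound : ∀ k ≥ 1, ‖h (k + 1) + ∑ i ∈ Finset.Icc 1 k, a i • h i‖ ≤ C) :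
    ∀ k ≥ 1, ‖h k‖ ≤ ‖h 1‖ + 2 * C := by
  intro k hk
  obtain rfl | ⟨m, hm, rfl⟩ : k = 1 ∨ ∃ m ≥ 1, k = m + 1 := by
    rcases hk.eq_or_lt with hk | hk
    · exact Or.inl hk.symm
    · exact Or.inr ⟨k - 1, by omega, by omega⟩
  · linarith
  · have hS := norm_sum_smul_le_of_norm_add_sum_le h a
      (fun k hk => ⟨(ha k hk).1, (ha k hk).2.le⟩) C hC hbound m hm
    have hb := hbound m hm
    have := norm_le_add_norm_add (h (m + 1)) (∑ i ∈ Finset.Icc 1 m, a i • h i)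
    linarith
end

section
/- (Single-step estimate for the Nesterov-first-scheme ADMM.) Under the Problem setup, let {(x_k, y_k, λ_k, u_k, v_k, λ̄_k, λ̂_k)}_{k≥1} satisfy Scheme A with α, β, γ > 0 and {t_k}_{k≥1} ⊆ [1, +∞) nondecreasing with t_{k+1}² ≤ t_k² + t_{k+1} for all k ≥ 1. Then for every saddle point (x*, y*, λ*) ∈ Ω and every k ≥ 1, E_{k+1} − E_k ≤ ((t_{k+2}² − t_{k+1}² − β·μ_g·t_{k+1})/(2β))·‖v_{k+1} − y*‖² − ((1 − α·L_{f2})/(2α))·‖u_{k+1} − u_k‖² − ((t_{k+1}² − β·L_{g2})/(2β))·‖v_{k+1} − v_k‖² + (1/(2γ))·‖λ_{k+1} − λ̄_{k+1}‖² + t_{k+1}·⟨B(v_{k+1} − y*), λ̄_{k+1} − λ̂_{k+1}⟩. -/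
set_option autoImplicit false

open RealInnerProductSpace

/-- The Lagrangian `𝓛(x,y,λ) = f1 x + f2 x + g1 y + g2 y + ⟪λ, Ax + By − b⟫`. -/
noncomputable def Lagr {m n p : ℕ}
    (f1 f2 : EuclideanSpace ℝ (Fin m) → ℝ)
    (g1 g2 : EuclideanSpace ℝ (Fin n) → ℝ)
    (A : EuclideanSpace ℝ (Fin m) →L[ℝ] EuclideanSpace ℝ (Fin p))
    (B : EuclideanSpace ℝ (Fin n) →L[ℝ] EuclideanSpace ℝ (Fin p))
    (b : EuclideanSpace ℝ (Fin p))
    (x : EuclideanSpace ℝ (Fin m)) (y : EuclideanSpace ℝ (Fin n))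
    (l : EuclideanSpace ℝ (Fin p)) : ℝ :=
  f1 x + f2 x + g1 y + g2 y + ⟪l, A x + B y - b⟫

section

variable {E : Type*} [NormedAddCommGroup E] [InnerProductSpace ℝ E]

theorem HasGradientAt.hasDerivAt_comp_line [CompleteSpace E] {f : E → ℝ} {f' : E → E}
    (hf : ∀ x, HasGradientAt f (f' x) x) (x d : E) (s : ℝ) :
    HasDerivAt (fun r : ℝ => f (x + r • d)) ⟪f' (x + s • d), d⟫ s := by
  have hline : HasDerivAt (fun r : ℝ => x + r • d) d s := by
    simpa using ((hasDerivAt_id s).smul_const d).const_add x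
  exact (hf (x + s • d)).hasFDerivAt.comp_hasDerivAt s hline

theorem ConvexOn.add_inner_gradient_le [CompleteSpace E] {f : E → ℝ} {f' : E → E}
    (hconv : ConvexOn ℝ Set.univ f) (hf : ∀ x, HasGradientAt f (f' x) x) (x z : E) :
    f x + ⟪f' x, z - x⟫ ≤ f z := by
  have hline : ConvexOn ℝ Set.univ (fun r : ℝ => f (x + r • (z - x))) := by
    refine ⟨convex_univ, fun r _ s _ a b ha hb hab => ?_⟩
    have h := hconv.2 (Set.mem_univ (x + r • (z - x))) (Set.mem_univ (x + s • (z - x))) ha hb hab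
    convert h using 2
    obtain rfl : b = 1 - a := by linarith
    simp only [smul_eq_mul]
    module
  have h := hline.le_slope_of_hasDerivAt (Set.mem_univ 0) (Set.mem_univ 1) one_pos
    (HasGradientAt.hasDerivAt_comp_line hf x (z - x) 0)
  simp only [slope_def_field, zero_smul, add_zero, one_smul, add_sub_cancel, sub_zero,
    div_one] at h
  linarith

theorem le_add_inner_gradient_add_sq [CompleteSpace E] {f : E → ℝ} {f' : E → E} {L : ℝ}
    (hf : ∀ x, HasGradientAt f (f' x) x) (hlip : ∀ x y, ‖f' x - f' y‖ ≤ L * ‖x - y‖) (x z : E) :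
    f z ≤ f x + ⟪f' x, z - x⟫ + L / 2 * ‖z - x‖ ^ 2 := by
  set d := z - x with hd
  have hφ := HasGradientAt.hasDerivAt_comp_line hf x d
  have hB : ∀ s : ℝ, HasDerivAt (fun r : ℝ => f x + r * ⟪f' x, d⟫ + L / 2 * ‖d‖ ^ 2 * r ^ 2)
      (⟪f' x, d⟫ + L * ‖d‖ ^ 2 * s) s := fun s => by
    refine ((((hasDerivAt_id s).mul_const ⟪f' x, d⟫).const_add (f x)).add
      ((hasDerivAt_pow 2 s).const_mul (L / 2 * ‖d‖ ^ 2))).congr_deriv ?_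
    norm_num
    ring
  have h := image_le_of_deriv_right_le_deriv_boundary (a := 0) (b := 1)
    (fun s _ => (hφ s).continuousAt.continuousWithinAt) (fun s _ => (hφ s).hasDerivWithinAt)
    (by simp) (fun s _ => (hB s).continuousAt.continuousWithinAt)
    (fun s _ => (hB s).hasDerivWithinAt) (fun s hs => ?_) (Set.right_mem_Icc.2 zero_le_one)
  · simp only [one_smul, hd, add_sub_cancel] at h ⊢
    linarith
  · have hgrad : ‖f' (x + s • d) - f' x‖ ≤ L * (s * ‖d‖) := by
      simpa [norm_smul, abs_of_nonneg hs.1] using hlip (x + s • d) x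
    have hinner := (real_inner_le_norm (f' (x + s • d) - f' x) d).trans
      (mul_le_mul_of_nonneg_right hgrad (norm_nonneg d))
    rw [inner_sub_left] at hinner
    linarith

theorem StrongConvexOn.add_inner_subgradient_add_sq_le {g : E → ℝ} {μ : ℝ}
    (hg : StrongConvexOn Set.univ μ g) {v ζ : E} (hζ : ∀ z, g v + ⟪ζ, z - v⟫ ≤ g z) (z : E) :
    g v + ⟪ζ, z - v⟫ + μ / 2 * ‖z - v‖ ^ 2 ≤ g z := by
  have hbound : ∀ s ∈ Set.Ioo (0 : ℝ) 1,
      g v + ⟪ζ, z - v⟫ + (1 - s) * (μ / 2 * ‖z - v‖ ^ 2) ≤ g z := fun s hs => by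
    have hconv := hg.2 (Set.mem_univ z) (Set.mem_univ v) hs.1.le (sub_nonneg.2 hs.2.le)
      (by ring : s + (1 - s) = 1)
    have hsub := hζ (s • z + (1 - s) • v)
    rw [show s • z + (1 - s) • v - v = s • (z - v) by module, inner_smul_right] at hsub
    simp only [smul_eq_mul] at hconv
    refine le_of_mul_le_mul_left ?_ hs.1
    linarith
  have hlim : Filter.Tendsto
      (fun s : ℝ => g v + ⟪ζ, z - v⟫ + (1 - s) * (μ / 2 * ‖z - v‖ ^ 2))
      (nhdsWithin 0 (Set.Ioi 0)) (nhds (g v + ⟪ζ, z - v⟫ + μ / 2 * ‖z - v‖ ^ 2)) := by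
    have hcont : Continuous
        (fun s : ℝ => g v + ⟪ζ, z - v⟫ + (1 - s) * (μ / 2 * ‖z - v‖ ^ 2)) := by fun_prop
    simpa using (hcont.tendsto 0).mono_left nhdsWithin_le_nhds
  exact le_of_tendsto hlim
    (Filter.eventually_of_mem (Ioo_mem_nhdsGT one_pos) hbound)

/-- One accelerated proximal-gradient step on the composite function `h₁ + h₂`. -/
theorem accelerated_composite_step [CompleteSpace E] {h₁ h₂ : E → ℝ} {h₂' : E → E} {L μ T : ℝ}
    (hT : 1 ≤ T) (h₁conv : ConvexOn ℝ Set.univ h₁) (h₂conv : ConvexOn ℝ Set.univ h₂)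
    (h₂grad : ∀ x, HasGradientAt h₂ (h₂' x) x)
    (h₂lip : ∀ x y, ‖h₂' x - h₂' y‖ ≤ L * ‖x - y‖)
    {x x₁ xbar w w₁ xs ξ : E}
    (hξ : h₁ w₁ + ⟪ξ, xs - w₁⟫ + μ / 2 * ‖xs - w₁‖ ^ 2 ≤ h₁ xs)
    (hxbar : xbar = x + (1 / T) • (w - x))
    (hx₁ : x₁ = (1 / T) • w₁ + ((T - 1) / T) • x) :
    T ^ 2 * (h₁ x₁ + h₂ x₁ - h₁ xs - h₂ xs) ≤
      T * (T - 1) * (h₁ x + h₂ x - h₁ xs - h₂ xs) + T * ⟪ξ + h₂' xbar, w₁ - xs⟫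
        - T * (μ / 2) * ‖w₁ - xs‖ ^ 2 + L / 2 * ‖w₁ - w‖ ^ 2 := by
  have hT0 : 0 < T := by linarith
  have hconv := h₁conv.2 (Set.mem_univ w₁) (Set.mem_univ x) (one_div_nonneg.2 hT0.le)
    (div_nonneg (sub_nonneg.2 hT) hT0.le) (by field_simp; ring)
  rw [← hx₁] at hconv
  have hconv' : T * h₁ x₁ ≤ h₁ w₁ + (T - 1) * h₁ x := by
    have h := mul_le_mul_of_nonneg_left hconv hT0.le
    simp only [smul_eq_mul] at h
    field_simp at h
    linarith
  have hdesc := le_add_inner_gradient_add_sq h₂grad h₂lip xbar x₁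
  have hxs := h₂conv.add_inner_gradient_le h₂grad xbar xs
  have hx := mul_le_mul_of_nonneg_left (h₂conv.add_inner_gradient_le h₂grad xbar x)
    (sub_nonneg.2 hT)
  have hnorm : T ^ 2 * ‖x₁ - xbar‖ ^ 2 = ‖w₁ - w‖ ^ 2 := by
    rw [show w₁ - w = T • (x₁ - xbar) by
      rw [hx₁, hxbar]
      match_scalars <;> field_simp
      ring,
      norm_smul, mul_pow, Real.norm_eq_abs, sq_abs]
  have hinner : T * ⟪h₂' xbar, x₁ - xbar⟫ =
      ⟪h₂' xbar, w₁ - xs⟫ + ⟪h₂' xbar, xs - xbar⟫ + (T - 1) * ⟪h₂' xbar, x - xbar⟫ := by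
    rw [← inner_smul_right, ← inner_smul_right, ← inner_add_right, ← inner_add_right]
    congr 1
    rw [hx₁]
    match_scalars <;> field_simp <;> ring
  have hξ' : ⟪ξ, xs - w₁⟫ = -⟪ξ, w₁ - xs⟫ := by rw [← inner_neg_right, neg_sub]
  rw [hξ', norm_sub_rev] at hξ
  rw [inner_add_left, ← hnorm]
  have hdescT := mul_le_mul_of_nonneg_left hdesc hT0.le
  have hmain : T * (h₁ x₁ + h₂ x₁ - h₁ xs - h₂ xs) ≤
      (T - 1) * (h₁ x + h₂ x - h₁ xs - h₂ xs) + (⟪ξ, w₁ - xs⟫ + ⟪h₂' xbar, w₁ - xs⟫)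
        - μ / 2 * ‖w₁ - xs‖ ^ 2 + T * (L / 2 * ‖x₁ - xbar‖ ^ 2) := by
    linarith
  have := mul_le_mul_of_nonneg_left hmain hT0.le
  linarith

theorem nesterov_extrapolation_eq {x w xbar : ℕ → E} {t : ℕ → ℝ} (ht1 : ∀ k ≥ 1, 1 ≤ t k)
    (hx0 : x 0 = x 1) (hw1 : w 1 = x 1)
    (hxbar : ∀ k ≥ 1, xbar k = x k + ((t k - 1) / t (k + 1)) • (x k - x (k - 1)))
    (hxupd : ∀ k ≥ 1, x (k + 1) =
      (1 / t (k + 1)) • w (k + 1) + ((t (k + 1) - 1) / t (k + 1)) • x k) {k : ℕ} (hk : 1 ≤ k) :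
    xbar k = x k + (1 / t (k + 1)) • (w k - x k) := by
  have hdiff : (t k - 1) • (x k - x (k - 1)) = w k - x k := by
    obtain rfl | ⟨j, hj, rfl⟩ : k = 1 ∨ ∃ j, 1 ≤ j ∧ k = j + 1 := by
      obtain _ | _ | j := k
      · omega
      · exact Or.inl rfl
      · exact Or.inr ⟨j + 1, by omega, rfl⟩
    · simp [hx0, hw1]
    · have hpos : t (j + 1) ≠ 0 := by linarith [ht1 (j + 1) hk]
      rw [Nat.add_sub_cancel, hxupd j hj]
      match_scalars <;> field_simp
      ring
  rw [hxbar k hk, ← hdiff, smul_smul, one_div_mul_eq_div]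

theorem two_mul_inner_sub_sub (a b c : E) :
    2 * ⟪a - b, a - c⟫ = ‖a - b‖ ^ 2 + ‖a - c‖ ^ 2 - ‖b - c‖ ^ 2 := by
  rw [show b - c = (a - c) - (a - b) by abel, norm_sub_sq_real (a - c) (a - b),
    real_inner_comm]
  ring

theorem two_mul_inner_sub_sub_add (a b c d : E) :
    2 * ⟪c - d, a - b⟫ + ‖a - c‖ ^ 2 - ‖b - c‖ ^ 2 = ‖a - d‖ ^ 2 - ‖b - d‖ ^ 2 := by
  simp only [← real_inner_self_eq_norm_sq, inner_sub_left, inner_sub_right, real_inner_comm a,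
    real_inner_comm b c, real_inner_comm b d]
  ring

end

/-- Single-step estimate (Lemma 2.1) for the Nesterov-first-scheme accelerated
linearized ADMM (Scheme A). -/
theorem stmt6 {m n p : ℕ}
    (A : EuclideanSpace ℝ (Fin m) →L[ℝ] EuclideanSpace ℝ (Fin p))
    (B : EuclideanSpace ℝ (Fin n) →L[ℝ] EuclideanSpace ℝ (Fin p))
    (b : EuclideanSpace ℝ (Fin p))
    (f1 f2 : EuclideanSpace ℝ (Fin m) → ℝ)
    (g1 g2 : EuclideanSpace ℝ (Fin n) → ℝ)
    (f2' : EuclideanSpace ℝ (Fin m) → EuclideanSpace ℝ (Fin m))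
    (g2' : EuclideanSpace ℝ (Fin n) → EuclideanSpace ℝ (Fin n))
    (Lf2 Lg2 μ : ℝ) (hLf2 : 0 ≤ Lf2) (hLg2 : 0 ≤ Lg2) (hμ : 0 < μ)
    -- Assumption 1.1
    (hf1lsc : LowerSemicontinuous f1) (hf1conv : ConvexOn ℝ Set.univ f1)
    (hf2conv : ConvexOn ℝ Set.univ f2)
    (hf2grad : ∀ x, HasGradientAt f2 (f2' x) x)
    (hf2lip : ∀ x y, ‖f2' x - f2' y‖ ≤ Lf2 * ‖x - y‖)
    (hg1lsc : LowerSemicontinuous g1) (hg1sc : StrongConvexOn Set.univ μ g1)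
    (hg2conv : ConvexOn ℝ Set.univ g2)
    (hg2grad : ∀ y, HasGradientAt g2 (g2' y) y)
    (hg2lip : ∀ x y, ‖g2' x - g2' y‖ ≤ Lg2 * ‖x - y‖)
    -- parameters
    (α β γ : ℝ) (hα : 0 < α) (hβ : 0 < β) (hγ : 0 < γ)
    (t : ℕ → ℝ) (ht1 : ∀ k ≥ 1, 1 ≤ t k) (htmono : ∀ k ≥ 1, t k ≤ t (k + 1))
    (htrec : ∀ k ≥ 1, t (k + 1) ^ 2 ≤ t k ^ 2 + t (k + 1))
    -- iterates of Scheme A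
    (x u xbar : ℕ → EuclideanSpace ℝ (Fin m))
    (y v ybar : ℕ → EuclideanSpace ℝ (Fin n))
    (lam lambar lamhat : ℕ → EuclideanSpace ℝ (Fin p))
    (ξ : ℕ → EuclideanSpace ℝ (Fin m)) (ζ : ℕ → EuclideanSpace ℝ (Fin n))
    (hx0 : x 0 = x 1) (hy0 : y 0 = y 1) (hu1 : u 1 = x 1) (hv1 : v 1 = y 1)
    (hxbar : ∀ k ≥ 1, xbar k = x k + ((t k - 1) / t (k + 1)) • (x k - x (k - 1)))
    (hybar : ∀ k ≥ 1, ybar k = y k + ((t k - 1) / t (k + 1)) • (y k - y (k - 1)))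
    (hξ : ∀ k ≥ 1, ∀ z, f1 (u (k + 1)) + ⟪ξ (k + 1), z - u (k + 1)⟫ ≤ f1 z)
    (hu : ∀ k ≥ 1, u (k + 1) - u k =
      -((α * t (k + 1)) • (ξ (k + 1) + f2' (xbar k) +
        ContinuousLinearMap.adjoint A (lambar (k + 1)))))
    (hζ : ∀ k ≥ 1, ∀ z, g1 (v (k + 1)) + ⟪ζ (k + 1), z - v (k + 1)⟫ ≤ g1 z)
    (hv : ∀ k ≥ 1, v (k + 1) - v k =
      -((β / t (k + 1)) • (ζ (k + 1) + g2' (ybar k) +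
        ContinuousLinearMap.adjoint B (lamhat (k + 1)))))
    (hxupd : ∀ k ≥ 1, x (k + 1) =
      (1 / t (k + 1)) • u (k + 1) + ((t (k + 1) - 1) / t (k + 1)) • x k)
    (hyupd : ∀ k ≥ 1, y (k + 1) =
      (1 / t (k + 1)) • v (k + 1) + ((t (k + 1) - 1) / t (k + 1)) • y k)
    (hlam : ∀ k ≥ 1, lam (k + 1) =
      lam k + (γ * t (k + 1)) • (A (u (k + 1)) + B (v (k + 1)) - b))
    (hlambar : ∀ k ≥ 1, lambar (k + 1) =
      lam k + (γ * t (k + 1)) • (A (u (k + 1)) + B (v k) - b))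
    (hlamhat : ∀ k ≥ 1, lamhat (k + 1) = lam (k + 1) ∨ lamhat (k + 1) = lambar (k + 1))
    -- saddle point
    (xs : EuclideanSpace ℝ (Fin m)) (ys : EuclideanSpace ℝ (Fin n))
    (lams : EuclideanSpace ℝ (Fin p))
    (hsaddle : ∀ xx yy ll,
      Lagr f1 f2 g1 g2 A B b xs ys ll ≤ Lagr f1 f2 g1 g2 A B b xs ys lams ∧
      Lagr f1 f2 g1 g2 A B b xs ys lams ≤ Lagr f1 f2 g1 g2 A B b xx yy lams) :
    -- conclusion
    let En : ℕ → ℝ := fun j =>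
      t j ^ 2 * (Lagr f1 f2 g1 g2 A B b (x j) (y j) lams -
        Lagr f1 f2 g1 g2 A B b xs ys lams) +
      1 / (2 * α) * ‖u j - xs‖ ^ 2 + t (j + 1) ^ 2 / (2 * β) * ‖v j - ys‖ ^ 2 +
      1 / (2 * γ) * ‖lam j - lams‖ ^ 2
    ∀ k ≥ 1,
      En (k + 1) - En k ≤
        (t (k + 2) ^ 2 - t (k + 1) ^ 2 - β * μ * t (k + 1)) / (2 * β) *
          ‖v (k + 1) - ys‖ ^ 2
        - (1 - α * Lf2) / (2 * α) * ‖u (k + 1) - u k‖ ^ 2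
        - (t (k + 1) ^ 2 - β * Lg2) / (2 * β) * ‖v (k + 1) - v k‖ ^ 2
        + 1 / (2 * γ) * ‖lam (k + 1) - lambar (k + 1)‖ ^ 2
        + t (k + 1) * ⟪B (v (k + 1) - ys), lambar (k + 1) - lamhat (k + 1)⟫ := by
  intro En k hk
  set T := t (k + 1) with hTdef
  have hT : 1 ≤ T := ht1 (k + 1) (by omega)
  have hT0 : 0 < T := by linarith
  have hfeas : A xs + B ys = b := by
    have h := (hsaddle xs ys (lams + (A xs + B ys - b))).1
    simp only [Lagr, inner_add_left, real_inner_self_eq_norm_sq] at h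
    have hz : ‖A xs + B ys - b‖ ^ 2 = 0 := le_antisymm (by linarith) (sq_nonneg _)
    exact sub_eq_zero.1 (norm_eq_zero.1 (pow_eq_zero_iff two_ne_zero |>.1 hz))
  have hf := accelerated_composite_step (μ := 0) hT hf1conv hf2conv hf2grad hf2lip
    (by simpa using hξ k hk xs) (nesterov_extrapolation_eq ht1 hx0 hu1 hxbar hxupd hk)
    (hxupd k hk)
  have hg := accelerated_composite_step hT (strongConvexOn_zero.1 (hg1sc.mono hμ.le)) hg2conv hg2grad hg2lip
    (hg1sc.add_inner_subgradient_add_sq_le (hζ k hk) ys)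
    (nesterov_extrapolation_eq ht1 hy0 hv1 hybar hyupd hk) (hyupd k hk)
  have hu' : T * ⟪ξ (k + 1) + f2' (xbar k), u (k + 1) - xs⟫ =
      -(1 / (2 * α)) * (‖u (k + 1) - u k‖ ^ 2 + ‖u (k + 1) - xs‖ ^ 2 - ‖u k - xs‖ ^ 2)
        - T * ⟪lambar (k + 1), A (u (k + 1) - xs)⟫ := by
    rw [← two_mul_inner_sub_sub, hu k hk, inner_neg_left, real_inner_smul_left,
      inner_add_left (_ + _), ContinuousLinearMap.adjoint_inner_left]
    field_simp
    ring
  have hv' : T * ⟪ζ (k + 1) + g2' (ybar k), v (k + 1) - ys⟫ =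
      -(T ^ 2 / (2 * β)) * (‖v (k + 1) - v k‖ ^ 2 + ‖v (k + 1) - ys‖ ^ 2 - ‖v k - ys‖ ^ 2)
        - T * ⟪lamhat (k + 1), B (v (k + 1) - ys)⟫ := by
    rw [← two_mul_inner_sub_sub, hv k hk, ← hTdef, inner_neg_left, real_inner_smul_left,
      inner_add_left (_ + _), ContinuousLinearMap.adjoint_inner_left]
    field_simp
    ring
  have hres : A (u (k + 1)) + B (v (k + 1)) - b = A (u (k + 1) - xs) + B (v (k + 1) - ys) := by
    rw [← hfeas, map_sub, map_sub]
    abel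
  have hdual : T * ⟪lams - lambar (k + 1), A (u (k + 1)) + B (v (k + 1)) - b⟫ +
      1 / (2 * γ) * ‖lam (k + 1) - lams‖ ^ 2 - 1 / (2 * γ) * ‖lam k - lams‖ ^ 2 ≤
      1 / (2 * γ) * ‖lam (k + 1) - lambar (k + 1)‖ ^ 2 := by
    have h := two_mul_inner_sub_sub_add (lam (k + 1)) (lam k) lams (lambar (k + 1))
    have hstep : ⟪lams - lambar (k + 1), lam (k + 1) - lam k⟫ =
        γ * T * ⟪lams - lambar (k + 1), A (u (k + 1)) + B (v (k + 1)) - b⟫ := by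
      rw [hlam k hk, add_sub_cancel_left, real_inner_smul_right]
    have hnn : 0 ≤ 1 / (2 * γ) * ‖lam k - lambar (k + 1)‖ ^ 2 := by positivity
    rw [hstep] at h
    have h' := congrArg (fun r => 1 / (2 * γ) * r) h
    field_simp at h' hnn ⊢
    linarith
  have hcon : T ^ 2 * ⟪lams, A (x (k + 1)) + B (y (k + 1)) - b⟫ =
      T * ⟪lams, A (u (k + 1)) + B (v (k + 1)) - b⟫ +
        T * (T - 1) * ⟪lams, A (x k) + B (y k) - b⟫ := by
    simp only [← real_inner_smul_right, ← inner_add_right]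
    congr 1
    rw [hxupd k hk, hyupd k hk]
    simp only [map_add, map_smul, ← hTdef]
    match_scalars <;> field_simp
    ring
  have hgap : T * (T - 1) * (Lagr f1 f2 g1 g2 A B b (x k) (y k) lams -
      Lagr f1 f2 g1 g2 A B b xs ys lams) ≤ t k ^ 2 * (Lagr f1 f2 g1 g2 A B b (x k) (y k) lams -
      Lagr f1 f2 g1 g2 A B b xs ys lams) :=
    mul_le_mul_of_nonneg_right (by linarith [htrec k hk])
      (sub_nonneg.2 (hsaddle (x k) (y k) lams).2)
  have hbracket : T * ⟪B (v (k + 1) - ys), lambar (k + 1) - lamhat (k + 1)⟫ =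
      T * ⟪lambar (k + 1), B (v (k + 1) - ys)⟫ - T * ⟪lamhat (k + 1), B (v (k + 1) - ys)⟫ := by
    rw [real_inner_comm, inner_sub_left]
    ring
  have hα' : (1 - α * Lf2) / (2 * α) = 1 / (2 * α) - Lf2 / 2 := by field_simp
  have hβ' : (T ^ 2 - β * Lg2) / (2 * β) = T ^ 2 / (2 * β) - Lg2 / 2 := by field_simp
  have hμ' : (t (k + 2) ^ 2 - T ^ 2 - β * μ * T) / (2 * β) =
      t (k + 2) ^ 2 / (2 * β) - T ^ 2 / (2 * β) - T * (μ / 2) := by field_simp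
  rw [inner_sub_left, hres, inner_add_right (lambar (k + 1)), ← hres] at hdual
  simp only [Lagr, hfeas, sub_self, inner_zero_right, add_zero] at hgap
  rw [hu'] at hf
  rw [hv'] at hg
  simp only [En, Lagr, hfeas, sub_self, inner_zero_right, add_zero, hα', hβ', hμ', hbracket,
    add_assoc k 1 1, one_add_one_eq_two, ← hTdef]
  linarith
end

section
/- (Accelerated linearized ALM, Nesterov's first scheme, convex case.) Consider minimizing f(x) = f1(x) + f2(x) over x ∈ ℝ^m subject to Ax = b, where f1 : ℝ^m → ℝ is lower semicontinuous and convex, f2 : ℝ^m → ℝ is convex and differentiable with L_{f2}-Lipschitz gradient, and the saddle point set Ω of the Lagrangian 𝓛(x,λ) = f(x) + ⟨λ, Ax − b⟩ is nonempty. Let (x*, λ*) ∈ Ω. Let the iterates, started from x_1 = x_0 ∈ ℝ^m, u_1 = x_1, λ_1 ∈ ℝ^p, with α, γ > 0 and {t_k}_{k≥1} ⊆ [1, +∞) nondecreasing satisfying t_{k+1}² ≤ t_k² + t_{k+1}, be given for k ≥ 1 by: x̄_k = x_k + ((t_k − 1)/t_{k+1})·(x_k − x_{k−1}); u_{k+1}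 − u_k = −α·t_{k+1}·(ξ_{k+1} + ∇f2(x̄_k) + Aᵀλ_{k+1}) for some ξ_{k+1} ∈ ∂f1(u_{k+1}), where λ_{k+1} = λ_k + γ·t_{k+1}·(A u_{k+1} − b); x_{k+1} = (1/t_{k+1})·u_{k+1} + ((t_{k+1} − 1)/t_{k+1})·x_k. If α ≤ 1/L_{f2}, then for all k ≥ 1: ‖A x_k − b‖ ≤ C_3/t_k² and |f(x_k) − f(x*)| ≤ (E_1 + C_3·‖λ*‖)/t_k², where E_1 = t_1²·(f(x_1) − f(x*) + ⟨λ*, A x_1 − b⟩) + (1/(2α))·‖x_1 − x*‖² + (1/(2γ))·‖λ_1 − λ*‖² and C_3 = 3·t_1²·‖A x_1 − b‖ + (2‖λ_1 − λ*‖ + 2√(2γ·E_1))/γ. -/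
set_option autoImplicit false

open RealInnerProductSpace

/-- First-order characterization of convexity for a function with a gradient. -/
lemma ConvexOn.add_inner_le_of_hasGradientAt {E : Type*} [NormedAddCommGroup E]
    [InnerProductSpace ℝ E] [CompleteSpace E] {f : E → ℝ} {g x : E}
    (hf : ConvexOn ℝ Set.univ f) (hg : HasGradientAt f g x) (y : E) :
    f x + ⟪g, y - x⟫ ≤ f y := by
  have hconv : ConvexOn ℝ Set.univ (fun r : ℝ => f (AffineMap.lineMap x y r)) := by
    simpa [Function.comp_def] using hf.comp_affineMap (AffineMap.lineMap (k := ℝ) x y)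
  have hline : HasDerivAt (fun r : ℝ => (AffineMap.lineMap x y r : E)) (y - x) 0 :=
    AffineMap.hasDerivAt_lineMap
  have hd : HasDerivAt (fun r : ℝ => f (AffineMap.lineMap x y r)) ⟪g, y - x⟫ 0 := by
    have hx : HasFDerivAt f (InnerProductSpace.toDual ℝ E g)
        (AffineMap.lineMap x y (0 : ℝ)) := by
      simpa using hg.hasFDerivAt
    simpa [Function.comp_def] using hx.comp_hasDerivAt (0 : ℝ) hline
  have := hconv.le_slope_of_hasDerivAt (Set.mem_univ 0) (Set.mem_univ 1) one_pos hd
  simp [slope_def_field] at this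
  linarith

/-- Descent lemma: quadratic upper bound for a function with Lipschitz gradient. -/
lemma le_quadratic_of_lipschitz_gradient {E : Type*} [NormedAddCommGroup E]
    [InnerProductSpace ℝ E] [CompleteSpace E] {f : E → ℝ} {g : E → E} {L : ℝ}
    (hg : ∀ x, HasGradientAt f (g x) x) (hL : ∀ x y, ‖g x - g y‖ ≤ L * ‖x - y‖) (x y : E) :
    f y ≤ f x + ⟪g x, y - x⟫ + L / 2 * ‖y - x‖ ^ 2 := by
  have hd (r : ℝ) : HasDerivAt
      (fun r : ℝ => f (x + r • (y - x)) - r * ⟪g x, y - x⟫ - L / 2 * ‖y - x‖ ^ 2 * r ^ 2)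
      (⟪g (x + r • (y - x)), y - x⟫ - ⟪g x, y - x⟫ - L * ‖y - x‖ ^ 2 * r) r := by
    have hline : HasDerivAt (fun r : ℝ => x + r • (y - x)) (y - x) r := by
      simpa using ((hasDerivAt_id r).smul_const (y - x)).const_add x
    have h1 : HasDerivAt (fun r : ℝ => f (x + r • (y - x))) ⟪g (x + r • (y - x)), y - x⟫ r := by
      simpa [Function.comp_def] using (hg (x + r • (y - x))).hasFDerivAt.comp_hasDerivAt r hline
    have h2 := (hasDerivAt_id r).mul_const ⟪g x, y - x⟫
    have h3 := (hasDerivAt_pow 2 r).const_mul (L / 2 * ‖y - x‖ ^ 2)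
    refine ((h1.sub h2).sub h3).congr_deriv ?_
    norm_num
    ring
  have hanti : AntitoneOn
      (fun r : ℝ => f (x + r • (y - x)) - r * ⟪g x, y - x⟫ - L / 2 * ‖y - x‖ ^ 2 * r ^ 2)
      (Set.Icc 0 1) := by
    refine antitoneOn_of_hasDerivWithinAt_nonpos (convex_Icc 0 1)
      (fun r _ => (hd r).continuousAt.continuousWithinAt)
      (fun r _ => (hd r).hasDerivWithinAt) fun r hr => ?_
    rw [interior_Icc] at hr
    have h1 : ⟪g (x + r • (y - x)) - g x, y - x⟫ ≤ L * ‖r • (y - x)‖ * ‖y - x‖ :=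
      (real_inner_le_norm _ _).trans <| by
        gcongr
        simpa using hL (x + r • (y - x)) x
    rw [norm_smul, Real.norm_of_nonneg hr.1.le, inner_sub_left] at h1
    linarith
  have := hanti (Set.left_mem_Icc.2 zero_le_one) (Set.right_mem_Icc.2 zero_le_one) zero_le_one
  simp only [one_smul, add_sub_cancel, zero_smul, add_zero] at this
  linarith

/-- If the increments of `c` are `a (k + 1) - a k + θ k • a k` with `θ k ∈ [0, 1]`, then a bound
on `c` gives a bound on `a`. -/
lemma norm_le_two_mul_of_relaxed_increments {F : Type*} [NormedAddCommGroup F] [NormedSpace ℝ F]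
    {a c : ℕ → F} {θ : ℕ → ℝ} {C : ℝ} (h1 : c 1 = a 1)
    (hθ : ∀ k ≥ 1, 0 ≤ θ k ∧ θ k ≤ 1)
    (hrec : ∀ k ≥ 1, c (k + 1) - c k = a (k + 1) - a k + θ k • a k)
    (hc : ∀ k ≥ 1, ‖c k‖ ≤ C) : ∀ k ≥ 1, ‖a k‖ ≤ 2 * C := by
  have key : ∀ k ≥ 1, ‖c k - a k‖ ≤ C := by
    intro k hk
    induction k, hk using Nat.le_induction with
    | base => simpa [h1] using (norm_nonneg _).trans (hc 1 le_rfl)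
    | succ k hk ih =>
      have heq : c (k + 1) - a (k + 1) = (1 - θ k) • (c k - a k) + θ k • c k := by
        rw [eq_add_of_sub_eq (hrec k hk)]
        module
      obtain ⟨h0, hle⟩ := hθ k hk
      calc ‖c (k + 1) - a (k + 1)‖ ≤ (1 - θ k) * ‖c k - a k‖ + θ k * ‖c k‖ := by
            rw [heq]
            refine (norm_add_le _ _).trans_eq ?_
            rw [norm_smul, norm_smul, Real.norm_of_nonneg h0,
              Real.norm_of_nonneg (sub_nonneg.2 hle)]
        _ ≤ (1 - θ k) * C + θ k * C := by
            gcongr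
            exact hc k hk
        _ = C := by ring
  intro k hk
  calc ‖a k‖ = ‖c k - (c k - a k)‖ := by rw [sub_sub_cancel]
    _ ≤ ‖c k‖ + ‖c k - a k‖ := norm_sub_le _ _
    _ ≤ 2 * C := by linarith [hc k hk, key k hk]

/-- One step of the accelerated linearized augmented Lagrangian method does not increase the
Lyapunov function. -/
lemma accelerated_alm_energy_step {E F : Type*} [NormedAddCommGroup E]
    [InnerProductSpace ℝ E] [CompleteSpace E] [NormedAddCommGroup F] [InnerProductSpace ℝ F]
    [CompleteSpace F] {A : E →L[ℝ] F} {b : F} {f1 f2 : E → ℝ} {f2' : E → E} {L : ℝ}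
    (hf1 : ConvexOn ℝ Set.univ f1) (hf2 : ConvexOn ℝ Set.univ f2)
    (hgrad : ∀ x, HasGradientAt f2 (f2' x) x)
    (hlip : ∀ x y, ‖f2' x - f2' y‖ ≤ L * ‖x - y‖)
    {α γ s r : ℝ} (hα : 0 < α) (hγ : 0 < γ) (hαL : L ≤ 1 / α) (hs : 1 ≤ s)
    (hsr : s ^ 2 ≤ r ^ 2 + s)
    {x u x' u' xbar ξ xs : E} {l l' ls : F}
    (hxbar : xbar = (1 / s) • u + ((s - 1) / s) • x)
    (hξ : ∀ z, f1 u' + ⟪ξ, z - u'⟫ ≤ f1 z)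
    (hu : u' - u = -((α * s) • (ξ + f2' xbar + ContinuousLinearMap.adjoint A l')))
    (hl : l' = l + (γ * s) • (A u' - b))
    (hx' : x' = (1 / s) • u' + ((s - 1) / s) • x)
    (hxs : A xs = b)
    (hsad : f1 xs + f2 xs ≤ f1 x + f2 x + ⟪ls, A x - b⟫) :
    s ^ 2 * (f1 x' + f2 x' - (f1 xs + f2 xs) + ⟪ls, A x' - b⟫) +
        1 / (2 * α) * ‖u' - xs‖ ^ 2 + 1 / (2 * γ) * ‖l' - ls‖ ^ 2 ≤
      r ^ 2 * (f1 x + f2 x - (f1 xs + f2 xs) + ⟪ls, A x - b⟫) +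
        1 / (2 * α) * ‖u - xs‖ ^ 2 + 1 / (2 * γ) * ‖l - ls‖ ^ 2 := by
  have hs0 : 0 < s := one_pos.trans_le hs
  have hw0 : 0 ≤ (s - 1) / s := div_nonneg (by linarith) hs0.le
  have hw : 1 / s + (s - 1) / s = 1 := by field_simp; ring
  have hF1 : s * f1 x' ≤ f1 u' + (s - 1) * f1 x := by
    have := hf1.2 (Set.mem_univ u') (Set.mem_univ x) (by positivity) hw0 hw
    rw [← hx', smul_eq_mul, smul_eq_mul] at this
    calc s * f1 x' ≤ s * (1 / s * f1 u' + (s - 1) / s * f1 x) := by gcongr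
      _ = _ := by field_simp
  have hF1s := hξ xs
  have hxx : x' - xbar = (1 / s) • (u' - u) := by rw [hx', hxbar]; module
  have hF2 := le_quadratic_of_lipschitz_gradient hgrad hlip xbar x'
  rw [hxx, norm_smul, mul_pow, inner_smul_right, Real.norm_of_nonneg (by positivity)] at hF2
  have hF2' : s ^ 2 * f2 x' ≤
      s ^ 2 * f2 xbar + s * ⟪f2' xbar, u' - u⟫ + L / 2 * ‖u' - u‖ ^ 2 := by
    calc s ^ 2 * f2 x' ≤ s ^ 2 * _ := mul_le_mul_of_nonneg_left hF2 (by positivity)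
      _ = _ := by field_simp
  have hC1 := hf2.add_inner_le_of_hasGradientAt (hgrad xbar) xs
  have hC2 := hf2.add_inner_le_of_hasGradientAt (hgrad xbar) x
  have hbar : ⟪f2' xbar, u⟫ = s * ⟪f2' xbar, xbar⟫ - (s - 1) * ⟪f2' xbar, x⟫ := by
    have : u = s • xbar - (s - 1) • x := by
      rw [hxbar]; match_scalars <;> field_simp <;> ring
    conv_lhs => rw [this]
    rw [inner_sub_right, inner_smul_right, inner_smul_right]
  have hF2s : s ^ 2 * f2 x' ≤ s * f2 xs + (s ^ 2 - s) * f2 x + s * ⟪f2' xbar, u' - xs⟫ +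
      L / 2 * ‖u' - u‖ ^ 2 := by
    rw [inner_sub_right] at hC1 hC2 hF2' ⊢
    have h1 := mul_le_mul_of_nonneg_left hC1 hs0.le
    have h2 := mul_le_mul_of_nonneg_left hC2 (mul_nonneg hs0.le (sub_nonneg.2 hs))
    rw [hbar] at hF2'
    linarith
  have hLα : L / 2 * ‖u' - u‖ ^ 2 ≤ 1 / (2 * α) * ‖u' - u‖ ^ 2 := by
    have : L / 2 ≤ 1 / (2 * α) := by
      calc L / 2 ≤ 1 / α / 2 := by gcongr
        _ = _ := by field_simp
    gcongr
  have hF1' : s ^ 2 * f1 x' ≤ s * f1 xs + (s ^ 2 - s) * f1 x + s * ⟪ξ, u' - xs⟫ := by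
    have h1 := mul_le_mul_of_nonneg_left hF1 hs0.le
    have h2 := mul_le_mul_of_nonneg_left hF1s hs0.le
    rw [← neg_sub u' xs, inner_neg_right] at h2
    linarith
  have hAx : s ^ 2 * ⟪ls, A x' - b⟫ = (s ^ 2 - s) * ⟪ls, A x - b⟫ + s * ⟪ls, A u' - b⟫ := by
    have : s ^ 2 • (A x' - b) = (s ^ 2 - s) • (A x - b) + s • (A u' - b) := by
      rw [hx', map_add, map_smul, map_smul]
      match_scalars <;> field_simp <;> ring
    rw [← inner_smul_right, ← inner_smul_right, ← inner_smul_right, this, inner_add_right]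
  have hprimal : s * ⟪ξ, u' - xs⟫ + s * ⟪f2' xbar, u' - xs⟫ + s * ⟪l', A u' - b⟫ =
      -(1 / α * ⟪u' - u, u' - xs⟫) := by
    rw [hu, inner_neg_left, inner_smul_left, inner_add_left, inner_add_left,
      ContinuousLinearMap.adjoint_inner_left, map_sub, hxs]
    simp only [conj_trivial]
    field_simp
  have hdual : s * ⟪l', A u' - b⟫ - s * ⟪ls, A u' - b⟫ = 1 / γ * ⟪l' - l, l' - ls⟫ := by
    have : l' - l = (γ * s) • (A u' - b) := by rw [hl]; abel
    rw [this, inner_smul_left, real_inner_comm (l' - ls), inner_sub_left]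
    simp only [conj_trivial]
    field_simp
  have hpu : ‖u - xs‖ ^ 2 = ‖u' - xs‖ ^ 2 - 2 * ⟪u' - u, u' - xs⟫ + ‖u' - u‖ ^ 2 := by
    rw [real_inner_comm, ← norm_sub_sq_real]; congr 2; abel
  have hpl : ‖l - ls‖ ^ 2 = ‖l' - ls‖ ^ 2 - 2 * ⟪l' - l, l' - ls⟫ + ‖l' - l‖ ^ 2 := by
    rw [real_inner_comm, ← norm_sub_sq_real]; congr 2; abel
  have hgap : (s ^ 2 - s) * (f1 x + f2 x - (f1 xs + f2 xs) + ⟪ls, A x - b⟫) ≤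
      r ^ 2 * (f1 x + f2 x - (f1 xs + f2 xs) + ⟪ls, A x - b⟫) := by
    gcongr
    · linarith
    · linarith
  have hl0 : 0 ≤ 1 / (2 * γ) * ‖l' - l‖ ^ 2 := by positivity
  have hα2 : 1 / α = 2 * (1 / (2 * α)) := by field_simp
  have hγ2 : 1 / γ = 2 * (1 / (2 * γ)) := by field_simp
  rw [hpu, hpl]
  rw [hα2] at hprimal
  rw [hγ2] at hdual
  linarith

/-- Accelerated linearized ALM based on Nesterov's first scheme (Algorithm 3),
convex case (Theorem 2.5): convergence rates for the one-block linearly constrained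
problem `min f1 + f2 s.t. Ax = b`. -/
theorem stmt9 {m p : ℕ}
    (A : EuclideanSpace ℝ (Fin m) →L[ℝ] EuclideanSpace ℝ (Fin p))
    (b : EuclideanSpace ℝ (Fin p))
    (f1 f2 : EuclideanSpace ℝ (Fin m) → ℝ)
    (f2' : EuclideanSpace ℝ (Fin m) → EuclideanSpace ℝ (Fin m))
    (Lf2 : ℝ) (hLf2 : 0 ≤ Lf2)
    (hf1lsc : LowerSemicontinuous f1) (hf1conv : ConvexOn ℝ Set.univ f1)
    (hf2conv : ConvexOn ℝ Set.univ f2)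
    (hf2grad : ∀ x, HasGradientAt f2 (f2' x) x)
    (hf2lip : ∀ x y, ‖f2' x - f2' y‖ ≤ Lf2 * ‖x - y‖)
    (α γ : ℝ) (hα : 0 < α) (hγ : 0 < γ) (hαle : α ≤ 1 / Lf2)
    (t : ℕ → ℝ) (ht1 : ∀ k ≥ 1, 1 ≤ t k) (htmono : ∀ k ≥ 1, t k ≤ t (k + 1))
    (htrec : ∀ k ≥ 1, t (k + 1) ^ 2 ≤ t k ^ 2 + t (k + 1))
    (x u xbar : ℕ → EuclideanSpace ℝ (Fin m))
    (lam : ℕ → EuclideanSpace ℝ (Fin p))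
    (ξ : ℕ → EuclideanSpace ℝ (Fin m))
    (hx0 : x 0 = x 1) (hu1 : u 1 = x 1)
    (hxbar : ∀ k ≥ 1, xbar k = x k + ((t k - 1) / t (k + 1)) • (x k - x (k - 1)))
    (hξ : ∀ k ≥ 1, ∀ z, f1 (u (k + 1)) + ⟪ξ (k + 1), z - u (k + 1)⟫ ≤ f1 z)
    (hu : ∀ k ≥ 1, u (k + 1) - u k =
      -((α * t (k + 1)) • (ξ (k + 1) + f2' (xbar k) +
        ContinuousLinearMap.adjoint A (lam (k + 1)))))
    (hlam : ∀ k ≥ 1, lam (k + 1) = lam k + (γ * t (k + 1)) • (A (u (k + 1)) - b))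
    (hxupd : ∀ k ≥ 1, x (k + 1) =
      (1 / t (k + 1)) • u (k + 1) + ((t (k + 1) - 1) / t (k + 1)) • x k)
    -- saddle point of the Lagrangian `𝓛(x,λ) = f1 x + f2 x + ⟪λ, A x − b⟫`
    (xs : EuclideanSpace ℝ (Fin m)) (lams : EuclideanSpace ℝ (Fin p))
    (hsaddle : ∀ (xx : EuclideanSpace ℝ (Fin m)) (ll : EuclideanSpace ℝ (Fin p)),
      f1 xs + f2 xs + ⟪ll, A xs - b⟫ ≤ f1 xs + f2 xs + ⟪lams, A xs - b⟫ ∧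
      f1 xs + f2 xs + ⟪lams, A xs - b⟫ ≤ f1 xx + f2 xx + ⟪lams, A xx - b⟫) :
    let E1 : ℝ :=
      t 1 ^ 2 * (f1 (x 1) + f2 (x 1) - (f1 xs + f2 xs) + ⟪lams, A (x 1) - b⟫) +
      1 / (2 * α) * ‖x 1 - xs‖ ^ 2 + 1 / (2 * γ) * ‖lam 1 - lams‖ ^ 2
    let C3 : ℝ :=
      3 * t 1 ^ 2 * ‖A (x 1) - b‖ +
        (2 * ‖lam 1 - lams‖ + 2 * Real.sqrt (2 * γ * E1)) / γ
    ∀ k ≥ 1,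
      ‖A (x k) - b‖ ≤ C3 / t k ^ 2 ∧
      |f1 (x k) + f2 (x k) - (f1 xs + f2 xs)| ≤ (E1 + C3 * ‖lams‖) / t k ^ 2 := by
  intro E1 C3
  have hAxs : A xs = b := by
    have h := (hsaddle xs (lams + (A xs - b))).1
    rw [inner_add_left, real_inner_self_eq_norm_sq] at h
    have h0 : ‖A xs - b‖ ^ 2 = 0 := le_antisymm (by linarith) (sq_nonneg _)
    exact sub_eq_zero.1 (norm_eq_zero.1 (pow_eq_zero_iff two_ne_zero |>.1 h0))
  have hgap (z : EuclideanSpace ℝ (Fin m)) :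
      f1 xs + f2 xs ≤ f1 z + f2 z + ⟪lams, A z - b⟫ := by
    simpa [hAxs] using (hsaddle z lams).2
  have hLα : Lf2 ≤ 1 / α := by
    rcases hLf2.eq_or_lt with h | h
    · rw [← h]; positivity
    · exact (le_one_div hα h).1 hαle
  have hpos (k : ℕ) (hk : k ≥ 1) : 0 < t k := one_pos.trans_le (ht1 k hk)
  have hbar (k : ℕ) (hk : k ≥ 1) :
      xbar k = (1 / t (k + 1)) • u k + ((t (k + 1) - 1) / t (k + 1)) • x k := by
    have hne' : t (k + 1) ≠ 0 := (hpos (k + 1) (by omega)).ne'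
    rw [hxbar k hk]
    rcases hk.eq_or_lt with rfl | hk2
    · rw [hu1, Nat.sub_self, hx0]
      match_scalars
      field_simp
      ring
    · obtain ⟨j, rfl⟩ : ∃ j, k = j + 1 := ⟨k - 1, by omega⟩
      have hne : t (j + 1) ≠ 0 := (hpos (j + 1) hk).ne'
      rw [Nat.add_sub_cancel, hxupd j (by omega)]
      match_scalars <;> field_simp <;> ring
  have hE : ∀ k ≥ 1, t k ^ 2 * (f1 (x k) + f2 (x k) - (f1 xs + f2 xs) + ⟪lams, A (x k) - b⟫) +
      1 / (2 * α) * ‖u k - xs‖ ^ 2 + 1 / (2 * γ) * ‖lam k - lams‖ ^ 2 ≤ E1 := by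
    intro k hk
    induction k, hk using Nat.le_induction with
    | base => rw [hu1]
    | succ k hk ih =>
      exact (accelerated_alm_energy_step hf1conv hf2conv hf2grad hf2lip hα hγ hLα
        (ht1 (k + 1) (by omega)) (htrec k hk) (hbar k hk) (hξ k hk) (hu k hk) (hlam k hk)
        (hxupd k hk) hAxs (hgap (x k))).trans ih
  have hgap0 (k : ℕ) :
      0 ≤ t k ^ 2 * (f1 (x k) + f2 (x k) - (f1 xs + f2 xs) + ⟪lams, A (x k) - b⟫) :=
    mul_nonneg (sq_nonneg _) (by linarith [hgap (x k)])
  have hu0 (k : ℕ) : 0 ≤ 1 / (2 * α) * ‖u k - xs‖ ^ 2 := by positivity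
  have hl0 (k : ℕ) : 0 ≤ 1 / (2 * γ) * ‖lam k - lams‖ ^ 2 := by positivity
  have hE1 : 0 ≤ E1 := by linarith [hE 1 le_rfl, hgap0 1, hu0 1, hl0 1]
  have hlamb (k : ℕ) (hk : k ≥ 1) : ‖lam k - lams‖ ≤ Real.sqrt (2 * γ * E1) := by
    refine Real.le_sqrt_of_sq_le ?_
    have h : 1 / (2 * γ) * ‖lam k - lams‖ ^ 2 ≤ E1 := by
      linarith [hE k hk, hgap0 k, hu0 k]
    calc ‖lam k - lams‖ ^ 2 = 2 * γ * (1 / (2 * γ) * ‖lam k - lams‖ ^ 2) := by field_simp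
      _ ≤ 2 * γ * E1 := by gcongr
  have hfeas : ∀ k ≥ 1, ‖t k ^ 2 • (A (x k) - b)‖ ≤
      2 * (t 1 ^ 2 * ‖A (x 1) - b‖ + 1 / γ * (‖lam 1 - lams‖ + Real.sqrt (2 * γ * E1))) := by
    refine norm_le_two_mul_of_relaxed_increments
      (c := fun k => t 1 ^ 2 • (A (x 1) - b) + (1 / γ) • (lam k - lam 1))
      (θ := fun k => (t k ^ 2 - t (k + 1) ^ 2 + t (k + 1)) / t k ^ 2) (by simp) ?_ ?_ ?_
    · intro k hk
      have h1 := ht1 (k + 1) (by omega)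
      have h2 := htrec k hk
      have h3 := hpos k hk
      refine ⟨div_nonneg (by linarith) (sq_nonneg _), ?_⟩
      rw [div_le_one (by positivity)]
      nlinarith
    · intro k hk
      have hne : t k ≠ 0 := (hpos k hk).ne'
      have hne' : t (k + 1) ≠ 0 := (hpos (k + 1) (by omega)).ne'
      simp only [smul_smul]
      rw [hlam k hk, hxupd k hk, map_add, map_smul, map_smul]
      match_scalars <;> field_simp <;> ring
    · intro k hk
      refine (norm_add_le _ _).trans ?_
      rw [norm_smul, norm_smul, Real.norm_of_nonneg (sq_nonneg _),
        Real.norm_of_nonneg (by positivity)]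
      gcongr
      calc ‖lam k - lam 1‖ = ‖(lam k - lams) - (lam 1 - lams)‖ := by rw [sub_sub_sub_cancel_right]
        _ ≤ ‖lam k - lams‖ + ‖lam 1 - lams‖ := norm_sub_le _ _
        _ ≤ _ := by linarith [hlamb k hk]
  intro k hk
  have ht2 : 0 < t k ^ 2 := pow_pos (hpos k hk) 2
  have hA : ‖A (x k) - b‖ ≤ C3 / t k ^ 2 := by
    have h := hfeas k hk
    rw [norm_smul, Real.norm_of_nonneg ht2.le] at h
    rw [le_div_iff₀ ht2]
    have h0 : 0 ≤ t 1 ^ 2 * ‖A (x 1) - b‖ := by positivity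
    have hC3 : C3 = 3 * (t 1 ^ 2 * ‖A (x 1) - b‖) +
        2 * (1 / γ * (‖lam 1 - lams‖ + Real.sqrt (2 * γ * E1))) := by
      simp only [C3]
      ring
    rw [hC3]
    linarith
  refine ⟨hA, ?_⟩
  have hin : |⟪lams, A (x k) - b⟫| ≤ C3 * ‖lams‖ / t k ^ 2 :=
    calc |⟪lams, A (x k) - b⟫| ≤ ‖lams‖ * ‖A (x k) - b‖ := abs_real_inner_le_norm _ _
      _ ≤ ‖lams‖ * (C3 / t k ^ 2) := by gcongr
      _ = _ := by ring
  have hup : f1 (x k) + f2 (x k) - (f1 xs + f2 xs) + ⟪lams, A (x k) - b⟫ ≤ E1 / t k ^ 2 := by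
    rw [le_div_iff₀ ht2]
    linarith [hE k hk, hu0 k, hl0 k]
  have hE0 : 0 ≤ E1 / t k ^ 2 := by positivity
  rw [add_div, abs_le]
  obtain ⟨hlo, hhi⟩ := abs_le.1 hin
  exact ⟨by linarith [hgap (x k)], by linarith⟩
end
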